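/- Let s < 0 and let φ: [0, ∞) → [0, ∞) be an integrable s-concave function (i.e. φ^s is convex on its support). Then p ↦ B(p, -1/s - p)^{-1} ∫₀^∞ t^{p-1} φ(t) dt is log-concave on the interval 0 < p < -1/s. -/

import Mathlib

open MeasureTheory Real

/-- The Beta function `B(x,y) = Γ(x)Γ(y)/Γ(x+y)`. -/
noncomputable def betaFn (x y : ℝ) : ℝ := Real.Gamma x * Real.Gamma y / Real.Gamma (x + y)

theorem lintegral_rpow_mul_exp_neg_mul_Ioi {a r : ℝ} (ha : 0 < a) (hr : 0 < r) :
    ∫⁻ t in Set.Ioi (0 : ℝ), ENNReal.ofReal (t ^ (a - 1) * exp (-(r * t))) =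
      ENNReal.ofReal ((1 / r) ^ a * Real.Gamma a) := by
  have h := integral_rpow_mul_exp_neg_mul_Ioi ha hr
  have hne : ∫ t in Set.Ioi (0 : ℝ), t ^ (a - 1) * exp (-(r * t)) ≠ 0 := by
    rw [h]
    have := Gamma_pos_of_pos ha
    positivity
  rw [← h, ofReal_integral_eq_lintegral_ofReal (not_imp_comm.1 integral_undef hne)]
  filter_upwards [ae_restrict_mem measurableSet_Ioi] with t ht
  have : (0 : ℝ) < t := ht
  positivity

theorem lintegral_rpow_mul_add_mul_rpow_Ioi {p m α β : ℝ} (hp : 0 < p) (hpm : p < m)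
    (hα : 0 < α) (hβ : 0 < β) :
    ∫⁻ t in Set.Ioi (0 : ℝ), ENNReal.ofReal (t ^ (p - 1) * (α + β * t) ^ (-m)) =
      ENNReal.ofReal (betaFn p (m - p) * (α ^ (p - m) * β ^ (-p))) := by
  have hm : 0 < m := hp.trans hpm
  have hG : 0 < Real.Gamma m := Gamma_pos_of_pos hm
  have hGp : 0 < Real.Gamma p := Gamma_pos_of_pos hp
  have key : (∫⁻ t in Set.Ioi (0 : ℝ), ENNReal.ofReal (t ^ (p - 1) * (α + β * t) ^ (-m)))
      * ENNReal.ofReal (Real.Gamma m) =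
      ENNReal.ofReal (Real.Gamma p * Real.Gamma (m - p) * (α ^ (p - m) * β ^ (-p))) := by
    rw [← lintegral_mul_const _ (by fun_prop)]
    calc
      _ = ∫⁻ t in Set.Ioi (0 : ℝ), ∫⁻ x in Set.Ioi (0 : ℝ),
            ENNReal.ofReal (t ^ (p - 1) * (x ^ (m - 1) * exp (-((α + β * t) * x)))) := by
          refine setLIntegral_congr_fun measurableSet_Ioi fun t ht => ?_
          have ht : 0 < t := ht
          have hl : 0 < α + β * t := by positivity
          simp_rw [ENNReal.ofReal_mul (show 0 ≤ t ^ (p - 1) by positivity)]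
          rw [lintegral_const_mul _ (by fun_prop), lintegral_rpow_mul_exp_neg_mul_Ioi hm hl,
            mul_assoc, ← ENNReal.ofReal_mul (by positivity), one_div, inv_rpow hl.le, rpow_neg hl.le]
      _ = ∫⁻ x in Set.Ioi (0 : ℝ), ∫⁻ t in Set.Ioi (0 : ℝ),
            ENNReal.ofReal (t ^ (p - 1) * (x ^ (m - 1) * exp (-((α + β * t) * x)))) := by
          refine lintegral_lintegral_swap ?_
          unfold Function.uncurry
          fun_prop
      _ = ∫⁻ x in Set.Ioi (0 : ℝ), ENNReal.ofReal (Real.Gamma p * β ^ (-p)) *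
            ENNReal.ofReal (x ^ (m - p - 1) * exp (-(α * x))) := by
          refine setLIntegral_congr_fun measurableSet_Ioi fun x hx => ?_
          have hx : 0 < x := hx
          have e : ∀ t, ENNReal.ofReal (t ^ (p - 1) * (x ^ (m - 1) * exp (-((α + β * t) * x)))) =
              ENNReal.ofReal (x ^ (m - 1) * exp (-(α * x))) *
                ENNReal.ofReal (t ^ (p - 1) * exp (-((β * x) * t))) := fun t => by
            rw [← ENNReal.ofReal_mul (by positivity),
              show -((α + β * t) * x) = -(α * x) + -((β * x) * t) by ring, exp_add]
            ring_nf
          simp_rw [e]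
          rw [lintegral_const_mul _ (by fun_prop),
            lintegral_rpow_mul_exp_neg_mul_Ioi hp (by positivity),
            ← ENNReal.ofReal_mul (by positivity), ← ENNReal.ofReal_mul (by positivity), one_div,
            inv_rpow (by positivity), ← rpow_neg (by positivity), mul_rpow hβ.le hx.le,
            show m - p - 1 = (m - 1) + (-p) by ring, rpow_add hx]
          ring_nf
      _ = _ := by
          rw [lintegral_const_mul _ (by fun_prop),
            lintegral_rpow_mul_exp_neg_mul_Ioi (sub_pos.2 hpm) hα,
            ← ENNReal.ofReal_mul (by positivity), one_div, inv_rpow hα.le, ← rpow_neg hα.le,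
            neg_sub]
          ring_nf
  have h0 : ENNReal.ofReal (Real.Gamma m) ≠ 0 := by simpa using hG
  rw [← ENNReal.mul_left_inj h0 ENNReal.ofReal_ne_top, key, ← ENNReal.ofReal_mul' hG.le, betaFn,
    add_sub_cancel]
  congr 1
  field_simp

theorem betaFn_pos {x y : ℝ} (hx : 0 < x) (hy : 0 < y) : 0 < betaFn x y :=
  div_pos (mul_pos (Gamma_pos_of_pos hx) (Gamma_pos_of_pos hy)) (Gamma_pos_of_pos (add_pos hx hy))

theorem integrableOn_rpow_mul_add_mul_rpow_Ioi {p m α β : ℝ} (hp : 0 < p) (hpm : p < m)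
    (hα : 0 < α) (hβ : 0 < β) :
    IntegrableOn (fun t : ℝ => t ^ (p - 1) * (α + β * t) ^ (-m)) (Set.Ioi 0) := by
  refine (lintegral_ofReal_ne_top_iff_integrable ?_ ?_).1
    ((lintegral_rpow_mul_add_mul_rpow_Ioi hp hpm hα hβ).trans_ne ENNReal.ofReal_ne_top)
  · exact Measurable.aestronglyMeasurable (by fun_prop)
  · filter_upwards [ae_restrict_mem measurableSet_Ioi] with t ht
    have : (0 : ℝ) < t := ht
    positivity

theorem integral_rpow_mul_add_mul_rpow_Ioi {p m α β : ℝ} (hp : 0 < p) (hpm : p < m)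
    (hα : 0 < α) (hβ : 0 < β) :
    ∫ t in Set.Ioi (0 : ℝ), t ^ (p - 1) * (α + β * t) ^ (-m) =
      betaFn p (m - p) * (α ^ (p - m) * β ^ (-p)) := by
  have hB := betaFn_pos hp (sub_pos.2 hpm)
  rw [integral_eq_lintegral_of_nonneg_ae, lintegral_rpow_mul_add_mul_rpow_Ioi hp hpm hα hβ,
    ENNReal.toReal_ofReal (by positivity)]
  · filter_upwards [ae_restrict_mem measurableSet_Ioi] with t ht
    have : (0 : ℝ) < t := ht
    positivity
  · exact Measurable.aestronglyMeasurable (by fun_prop)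

theorem rpow_le_tangent {l v x : ℝ} (hl0 : 0 < l) (hl1 : l < 1) (hv : 0 < v) (hx : 0 < x) :
    x ^ l ≤ (1 - l) * v ^ l + l * v ^ (l - 1) * x := by
  have h := geom_mean_le_arith_mean2_weighted hl0.le (sub_pos.2 hl1).le hx.le hv.le (by ring)
  have hm := mul_le_mul_of_nonneg_right h (rpow_pos_of_pos hv (l - 1)).le
  have e1 : v ^ (1 - l) * v ^ (l - 1) = 1 := by
    rw [← rpow_add hv]; simp
  have e2 : v * v ^ (l - 1) = v ^ l := by
    rw [rpow_sub_one hv.ne']; field_simp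
  calc x ^ l = x ^ l * v ^ (1 - l) * v ^ (l - 1) := by rw [mul_assoc, e1, mul_one]
    _ ≤ _ := hm
    _ = _ := by rw [← e2]; ring

/-- The sign pattern of `x ^ l` minus an affine function can be matched to any interval. -/
theorem exists_affine_separating_rpow {l : ℝ} (hl0 : 0 < l) (hl1 : l < 1) {S : Set ℝ}
    (hS0 : S ⊆ Set.Ioi 0) (hS : S.OrdConnected) :
    ∃ a b : ℝ, (∀ x ∈ S, 0 ≤ x ^ l - a - b * x) ∧
      ∀ x, 0 < x → x ∉ S → x ^ l - a - b * x ≤ 0 := by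
  rcases S.eq_empty_or_nonempty with rfl | hne
  · refine ⟨(1 - l) * 1 ^ l, l * 1 ^ (l - 1), by simp, fun x hx _ => ?_⟩
    linarith [rpow_le_tangent hl0 hl1 one_pos hx]
  have hbb : BddBelow S := ⟨0, fun x hx => (hS0 hx).le⟩
  have hu0 : 0 ≤ sInf S := le_csInf hne fun x hx => (hS0 hx).le
  have hmem_of : ∀ x, sInf S < x → (∃ y ∈ S, x < y) → x ∈ S := fun x hx ⟨y, hy, hxy⟩ => by
    obtain ⟨z, hz, hzx⟩ := exists_lt_of_csInf_lt hne hx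
    exact hS.out hz hy ⟨hzx.le, hxy.le⟩
  by_cases hba : BddAbove S
  · obtain ⟨z, hz⟩ := hne
    have huv : sInf S ≤ sSup S := (csInf_le hbb hz).trans (le_csSup hba hz)
    have hv0 : 0 < sSup S := (hS0 hz).trans_le (le_csSup hba hz)
    have hout : ∀ x, x ∉ S → x ≤ sInf S ∨ sSup S ≤ x := fun x hx => by
      by_contra! h
      exact hx (hmem_of x h.1 (exists_lt_of_lt_csSup ⟨z, hz⟩ h.2))
    have hin : ∀ x ∈ S, sInf S ≤ x ∧ x ≤ sSup S := fun x hx => ⟨csInf_le hbb hx, le_csSup hba hx⟩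
    generalize sInf S = u at *
    generalize sSup S = v at *
    rcases huv.eq_or_lt with rfl | huv
    · refine ⟨(1 - l) * u ^ l, l * u ^ (l - 1), fun x hx => ?_, fun x hx _ => ?_⟩
      · obtain rfl : x = u := le_antisymm (hin x hx).2 (hin x hx).1
        rw [rpow_sub_one hv0.ne']
        field_simp
        linarith
      · linarith [rpow_le_tangent hl0 hl1 hv0 hx]
    · have hc := concaveOn_rpow hl0.le hl1.le
      have hd : 0 < v - u := sub_pos.2 huv
      set b := (v ^ l - u ^ l) / (v - u) with hb
      have hbv : b * (v - u) = v ^ l - u ^ l := by rw [hb]; field_simp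
      refine ⟨u ^ l - b * u, b, fun x hx => ?_, fun x hx hxS => ?_⟩
      · obtain ⟨h1, h2⟩ := hin x hx
        rcases h1.eq_or_lt with rfl | h1
        · linarith
        rcases h2.eq_or_lt with rfl | h2
        · linarith
        have := hc.slope_anti_adjacent (x := u) (y := x) (z := v) hu0 hv0.le h1 h2
        rw [div_le_div_iff₀ (sub_pos.2 h2) (sub_pos.2 h1)] at this
        have h3 : 0 ≤ (x ^ l - u ^ l - b * (x - u)) * (v - u) := by
          linear_combination this + (x - u) * hbv
        have := nonneg_of_mul_nonneg_left h3 hd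
        linarith
      · rcases hout x hxS with h | h
        · rcases h.eq_or_lt with rfl | h
          · linarith
          have := hc.slope_anti_adjacent (x := x) (y := u) (z := v) hx.le hv0.le h huv
          rw [← hb, le_div_iff₀ (sub_pos.2 h)] at this
          linarith
        · rcases h.eq_or_lt with rfl | h
          · linarith
          have := hc.slope_anti_adjacent (x := u) (y := v) (z := x) hu0 hx.le huv h
          rw [← hb, div_le_iff₀ (sub_pos.2 h)] at this
          linarith
  · have hmem : ∀ x, sInf S < x → x ∈ S := fun x hx => hmem_of x hx (not_bddAbove_iff.1 hba x)
    refine ⟨(sInf S) ^ l, 0, fun x hx => ?_, fun x hx hxS => ?_⟩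
    · have := rpow_le_rpow hu0 (csInf_le hbb hx) hl0.le
      linarith
    · have := rpow_le_rpow hx.le (not_lt.1 fun h => hxS (hmem x h)) hl0.le
      linarith

/-- An `s`-concave function with a finite moment of order `p < -1/s` is bounded near the origin. -/
theorem exists_bound_near_zero {s p : ℝ} (hs : s < 0) (hps : p < -1 / s) {φ : ℝ → ℝ}
    (hφ : ∀ t, 0 ≤ φ t) (hconv : ConvexOn ℝ {t : ℝ | 0 ≤ t ∧ 0 < φ t} (fun t => φ t ^ s))
    (hint : IntegrableOn (fun t => t ^ (p - 1) * φ t) (Set.Ioi 0)) :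
    ∃ ε > 0, ∃ C, ∀ t, 0 < t → t < ε → φ t ≤ C := by
  by_cases h : ∃ u b, 0 < u ∧ u < b ∧ 0 < φ u ∧ 0 < φ b ∧ u * φ b ^ s < b * φ u ^ s
  · obtain ⟨u, b, hu, hub, hφu, hφb, hlt⟩ := h
    have hd : 0 < b - u := sub_pos.2 hub
    set k := (φ b ^ s - φ u ^ s) / (b - u) with hk
    have hk' : k * (b - u) = φ b ^ s - φ u ^ s := by rw [hk]; field_simp
    have hgu : 0 < φ u ^ s := rpow_pos_of_pos hφu s
    have hku : 0 < φ u ^ s - k * u := by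
      have h3 : 0 < (φ u ^ s - k * u) * (b - u) := by linear_combination hlt + u * hk'
      exact pos_of_mul_pos_left h3 hd.le
    have hc := lt_min hgu hku
    refine ⟨u, hu, (min (φ u ^ s) (φ u ^ s - k * u)) ^ s⁻¹, fun t ht htu => ?_⟩
    rcases (hφ t).eq_or_lt with h0 | hpos
    · rw [← h0]; positivity
    rw [le_rpow_inv_iff_of_neg hpos hc hs]
    have hsl := hconv.slope_mono_adjacent (x := t) (y := u) (z := b) ⟨ht.le, hpos⟩
      ⟨(hu.trans hub).le, hφb⟩ htu hub
    rw [← hk, div_le_iff₀ (sub_pos.2 htu)] at hsl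
    rcases le_total 0 k with h0 | h0
    · refine (min_le_right _ _).trans ?_
      nlinarith
    · refine (min_le_left _ _).trans ?_
      nlinarith
  · by_cases hz : ∃ ε > 0, ∀ t, 0 < t → t < ε → φ t = 0
    · obtain ⟨ε, hε, hz⟩ := hz
      exact ⟨ε, hε, 0, fun t h1 h2 => (hz t h1 h2).le⟩
    exfalso
    push Not at h hz
    obtain ⟨b, hb, -, hφb⟩ := hz 1 one_pos
    have hφb : 0 < φ b := lt_of_le_of_ne (hφ b) hφb.symm
    have hgb : 0 < φ b ^ s := rpow_pos_of_pos hφb s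
    have hlow : ∀ t ∈ Set.Ioo 0 b, (φ b ^ s / b) ^ s⁻¹ * t ^ s⁻¹ ≤ φ t := fun t ht => by
      obtain ⟨r, hr, hrt, hφr⟩ := hz t ht.1
      have hφr : 0 < φ r := lt_of_le_of_ne (hφ r) hφr.symm
      have hφt : 0 < φ t :=
        (hconv.1.ordConnected.out ⟨hr.le, hφr⟩ ⟨hb.le, hφb⟩ ⟨hrt.le, ht.2.le⟩).2
      have ht0 : 0 < t := ht.1
      rw [← mul_rpow (by positivity) ht0.le, rpow_inv_le_iff_of_neg (by positivity) hφt hs,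
        div_mul_eq_mul_div, le_div_iff₀ hb]
      linarith [h t b ht0 ht.2 hφt hφb]
    have hI : IntegrableOn (fun t : ℝ => t ^ (p - 1 + s⁻¹)) (Set.Ioo 0 b) := by
      refine Integrable.mono' ((hint.mono_set Set.Ioo_subset_Ioi_self).const_mul
        ((φ b ^ s / b) ^ s⁻¹)⁻¹) (Measurable.aestronglyMeasurable (by fun_prop)) ?_
      filter_upwards [ae_restrict_mem measurableSet_Ioo] with t ht
      have ht0 : 0 < t := ht.1
      have hK : 0 < (φ b ^ s / b) ^ s⁻¹ := by positivity
      rw [norm_of_nonneg (by positivity), inv_mul_eq_div, le_div_iff₀ hK, rpow_add ht0]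
      calc _ = t ^ (p - 1) * ((φ b ^ s / b) ^ s⁻¹ * t ^ s⁻¹) := by ring
        _ ≤ _ := mul_le_mul_of_nonneg_left (hlow t ht) (by positivity)
    rw [intervalIntegral.integrableOn_Ioo_rpow_iff hb] at hI
    rw [neg_div, one_div] at hps
    linarith

/-- An `s`-concave function with a finite moment of positive order decays like `t ^ (1/s)`. -/
theorem exists_bound_near_top {s p : ℝ} (hs : s < 0) (hp : 0 < p) {φ : ℝ → ℝ}
    (hφ : ∀ t, 0 ≤ φ t) (hconv : ConvexOn ℝ {t : ℝ | 0 ≤ t ∧ 0 < φ t} (fun t => φ t ^ s))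
    (hint : IntegrableOn (fun t => t ^ (p - 1) * φ t) (Set.Ioi 0)) :
    ∃ T > 0, ∃ C, ∀ t, T < t → φ t ≤ C * t ^ s⁻¹ := by
  by_cases h : ∃ a u, 0 < a ∧ a < u ∧ 0 < φ a ∧ 0 < φ u ∧ φ a ^ s < φ u ^ s
  · obtain ⟨a, u, ha, hau, hφa, hφu, hlt⟩ := h
    have hu : 0 < u := ha.trans hau
    have hgu : 0 < φ u ^ s := rpow_pos_of_pos hφu s
    set k := (φ u ^ s - φ a ^ s) / (u - a) with hk
    have hk0 : 0 < k := div_pos (sub_pos.2 hlt) (sub_pos.2 hau)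
    have hc : 0 < min k (φ u ^ s / u) := lt_min hk0 (div_pos hgu hu)
    have hck := min_le_left k (φ u ^ s / u)
    have hcu := min_le_right k (φ u ^ s / u)
    rw [le_div_iff₀ hu] at hcu
    generalize min k (φ u ^ s / u) = c at *
    refine ⟨u, hu, c ^ s⁻¹, fun t hut => ?_⟩
    have ht : 0 < t := hu.trans hut
    rcases (hφ t).eq_or_lt with h0 | hpos
    · rw [← h0]; positivity
    rw [← mul_rpow hc.le ht.le, le_rpow_inv_iff_of_neg hpos (by positivity) hs]
    have hsl := hconv.slope_mono_adjacent (x := a) (y := u) (z := t) ⟨ha.le, hφa⟩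
      ⟨ht.le, hpos⟩ hau hut
    rw [← hk, le_div_iff₀ (sub_pos.2 hut)] at hsl
    nlinarith [mul_le_mul_of_nonneg_right hck (sub_pos.2 hut).le]
  · by_cases hz : ∃ T > 0, ∀ t, T < t → φ t = 0
    · obtain ⟨T, hT, hz⟩ := hz
      exact ⟨T, hT, 0, fun t h => by simp [hz t h]⟩
    exfalso
    push Not at h hz
    obtain ⟨a, ha, hφa⟩ := hz 1 one_pos
    have ha : 0 < a := one_pos.trans ha
    have hφa : 0 < φ a := lt_of_le_of_ne (hφ a) hφa.symm
    have hlow : ∀ t ∈ Set.Ioi a, φ a ≤ φ t := fun t ht => by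
      have ht0 : 0 < t := ha.trans ht
      obtain ⟨r, hrt, hφr⟩ := hz t ht0
      have hφr : 0 < φ r := lt_of_le_of_ne (hφ r) hφr.symm
      have hφt : 0 < φ t :=
        (hconv.1.ordConnected.out ⟨ha.le, hφa⟩ ⟨(ht0.trans hrt).le, hφr⟩
          ⟨(Set.mem_Ioi.1 ht).le, hrt.le⟩).2
      exact (rpow_le_rpow_iff_of_neg hφt hφa hs).1 (h a t ha ht hφa hφt)
    have hI : IntegrableOn (fun t : ℝ => t ^ (p - 1)) (Set.Ioi a) := by
      refine Integrable.mono' ((hint.mono_set (Set.Ioi_subset_Ioi ha.le)).const_mul (φ a)⁻¹)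
        (Measurable.aestronglyMeasurable (by fun_prop)) ?_
      filter_upwards [ae_restrict_mem measurableSet_Ioi] with t ht
      have ht0 : 0 < t := ha.trans ht
      rw [norm_of_nonneg (by positivity), inv_mul_eq_div, le_div_iff₀ hφa]
      exact mul_le_mul_of_nonneg_left (hlow t ht) (by positivity)
    rw [integrableOn_Ioi_rpow_iff ha] at hI
    linarith

/-- The finiteness of the moment of order `p` does not depend on `p ∈ (0, -1/s)`. -/
theorem integrableOn_rpow_mul_of_integrableOn {s p q : ℝ} (hs : s < 0)
    (hp : p ∈ Set.Ioo 0 (-1 / s)) (hq : q ∈ Set.Ioo 0 (-1 / s)) {φ : ℝ → ℝ}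
    (hφ : ∀ t, 0 ≤ φ t) (hφ_int : IntegrableOn φ (Set.Ioi 0))
    (hconv : ConvexOn ℝ {t : ℝ | 0 ≤ t ∧ 0 < φ t} (fun t => φ t ^ s))
    (hint : IntegrableOn (fun t => t ^ (p - 1) * φ t) (Set.Ioi 0)) :
    IntegrableOn (fun t => t ^ (q - 1) * φ t) (Set.Ioi 0) := by
  obtain ⟨ε, hε, C, hC⟩ := exists_bound_near_zero hs hp.2 hφ hconv hint
  obtain ⟨T, hT, K, hK⟩ := exists_bound_near_top hs hp.1 hφ hconv hint
  have hmeas : AEStronglyMeasurable (fun t => t ^ (q - 1) * φ t)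
      (volume.restrict (Set.Ioi (0 : ℝ))) :=
    (Measurable.aestronglyMeasurable (by fun_prop)).mul hφ_int.aestronglyMeasurable
  have h1 : IntegrableOn (fun t => t ^ (q - 1) * φ t) (Set.Ioo 0 ε) := by
    have hI : IntegrableOn (fun t : ℝ => t ^ (q - 1)) (Set.Ioo 0 ε) :=
      (intervalIntegral.integrableOn_Ioo_rpow_iff hε).2 (by linarith [hq.1])
    refine Integrable.mono' (hI.mul_const C)
      (hmeas.mono_measure (Measure.restrict_mono_set _ Set.Ioo_subset_Ioi_self)) ?_
    filter_upwards [ae_restrict_mem measurableSet_Ioo] with t ht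
    have ht0 : 0 < t := ht.1
    rw [norm_of_nonneg (mul_nonneg (by positivity) (hφ t))]
    exact mul_le_mul_of_nonneg_left (hC t ht.1 ht.2) (by positivity)
  have h2 : IntegrableOn (fun t => t ^ (q - 1) * φ t) (Set.Icc ε T) := by
    refine IntegrableOn.continuousOn_mul (fun t ht => ?_)
      (hφ_int.mono_set fun t ht => hε.trans_le ht.1) isCompact_Icc
    exact (continuousAt_rpow_const t _ (Or.inl (hε.trans_le ht.1).ne')).continuousWithinAt
  have h3 : IntegrableOn (fun t => t ^ (q - 1) * φ t) (Set.Ioi T) := by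
    have hI : IntegrableOn (fun t : ℝ => t ^ (q - 1 + s⁻¹)) (Set.Ioi T) := by
      refine integrableOn_Ioi_rpow_of_lt ?_ hT
      have := hq.2
      rw [neg_div, one_div] at this
      linarith
    refine Integrable.mono' (hI.const_mul K)
      (hmeas.mono_measure (Measure.restrict_mono_set _ (Set.Ioi_subset_Ioi hT.le))) ?_
    filter_upwards [ae_restrict_mem measurableSet_Ioi] with t ht
    have ht0 : 0 < t := hT.trans ht
    rw [norm_of_nonneg (mul_nonneg (by positivity) (hφ t)), rpow_add ht0]
    calc _ ≤ t ^ (q - 1) * (K * t ^ s⁻¹) := mul_le_mul_of_nonneg_left (hK t ht) (by positivity)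
      _ = _ := by ring
  refine ((h1.union h2).union h3).mono_set fun t ht => ?_
  rcases lt_or_ge t ε with h | h
  · exact Or.inl (Or.inl ⟨ht, h⟩)
  rcases le_or_gt t T with h' | h'
  · exact Or.inl (Or.inr ⟨h, h'⟩)
  · exact Or.inr h'

/-- The set where an `s`-concave function exceeds `(α + β t) ^ (1/s)` is an interval. -/
theorem ordConnected_setOf_add_mul_rpow_lt {s α β : ℝ} (hs : s < 0) (hα : 0 < α) (hβ : 0 < β)
    {φ : ℝ → ℝ} (hconv : ConvexOn ℝ {t : ℝ | 0 ≤ t ∧ 0 < φ t} (fun t => φ t ^ s)) :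
    {t : ℝ | 0 < t ∧ (α + β * t) ^ s⁻¹ < φ t}.OrdConnected := by
  have hset : {t : ℝ | 0 < t ∧ (α + β * t) ^ s⁻¹ < φ t} =
      Set.Ioi 0 ∩ {t ∈ {t : ℝ | 0 ≤ t ∧ 0 < φ t} | φ t ^ s - (α + β * t) < 0} := by
    ext t
    simp only [Set.mem_ofPred_eq, Set.mem_inter_iff, Set.mem_Ioi]
    refine and_congr_right fun ht => ?_
    have hl : 0 < α + β * t := by positivity
    constructor
    · intro h
      have hφt : 0 < φ t := (rpow_pos_of_pos hl _).trans h
      exact ⟨⟨ht.le, hφt⟩, sub_neg.2 ((rpow_inv_lt_iff_of_neg hl hφt hs).1 h)⟩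
    · rintro ⟨⟨-, hφt⟩, h⟩
      exact (rpow_inv_lt_iff_of_neg hl hφt hs).2 (sub_neg.1 h)
  have haff : ConcaveOn ℝ {t : ℝ | 0 ≤ t ∧ 0 < φ t} (fun t => α + β * t) := by
    refine ⟨hconv.1, fun x _ y _ a b _ _ hab => le_of_eq ?_⟩
    simp only [smul_eq_mul]
    linear_combination α * hab
  rw [hset]
  exact Set.OrdConnected.inter Set.ordConnected_Ioi ((hconv.sub haff).convex_lt 0).ordConnected

/-- A comparison principle: if `φ` has the same moments of orders `p < q` as
`(α + β t) ^ (1/s)`, then its intermediate moments are at least as large. -/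
theorem integral_rpow_mul_add_mul_rpow_le {s p q a b α β : ℝ} (hs : s < 0)
    (hp : p ∈ Set.Ioo 0 (-1 / s)) (hq : q ∈ Set.Ioo 0 (-1 / s)) (hpq : p < q)
    (ha : 0 < a) (hb : 0 < b) (hab : a + b = 1) (hα : 0 < α) (hβ : 0 < β) {φ : ℝ → ℝ}
    (hconv : ConvexOn ℝ {t : ℝ | 0 ≤ t ∧ 0 < φ t} (fun t => φ t ^ s))
    (hip : IntegrableOn (fun t => t ^ (p - 1) * φ t) (Set.Ioi 0))
    (hiq : IntegrableOn (fun t => t ^ (q - 1) * φ t) (Set.Ioi 0))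
    (hir : IntegrableOn (fun t => t ^ (a * p + b * q - 1) * φ t) (Set.Ioi 0))
    (hep : ∫ t in Set.Ioi (0 : ℝ), t ^ (p - 1) * φ t =
      ∫ t in Set.Ioi (0 : ℝ), t ^ (p - 1) * (α + β * t) ^ (-(-1 / s)))
    (heq : ∫ t in Set.Ioi (0 : ℝ), t ^ (q - 1) * φ t =
      ∫ t in Set.Ioi (0 : ℝ), t ^ (q - 1) * (α + β * t) ^ (-(-1 / s))) :
    ∫ t in Set.Ioi (0 : ℝ), t ^ (a * p + b * q - 1) * (α + β * t) ^ (-(-1 / s)) ≤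
      ∫ t in Set.Ioi (0 : ℝ), t ^ (a * p + b * q - 1) * φ t := by
  have hr : a * p + b * q ∈ Set.Ioo 0 (-1 / s) :=
    (convex_Ioo (0 : ℝ) (-1 / s)) hp hq ha.le hb.le hab
  have hjp := integrableOn_rpow_mul_add_mul_rpow_Ioi hp.1 hp.2 hα hβ
  have hjq := integrableOn_rpow_mul_add_mul_rpow_Ioi hq.1 hq.2 hα hβ
  have hjr := integrableOn_rpow_mul_add_mul_rpow_Ioi hr.1 hr.2 hα hβ
  have hs' : -(-1 / s) = s⁻¹ := by rw [neg_div, one_div, neg_neg]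
  rw [hs'] at hjp hjq hjr hep heq ⊢
  have hd : 0 < q - p := sub_pos.2 hpq
  have hS := ordConnected_setOf_add_mul_rpow_lt hs hα hβ hconv
  set S := {t : ℝ | 0 < t ∧ (α + β * t) ^ s⁻¹ < φ t}
  obtain ⟨c, d, hin, hout⟩ := exists_affine_separating_rpow (l := b) hb (by linarith)
    (S := {x : ℝ | 0 < x ∧ x ^ (q - p)⁻¹ ∈ S}) (fun x hx => hx.1)
    ⟨fun x hx y hy z hz => ⟨hx.1.trans_le hz.1, hS.out hx.2 hy.2
      ⟨rpow_le_rpow hx.1.le hz.1 (by positivity),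
        rpow_le_rpow (hx.1.trans_le hz.1).le hz.2 (by positivity)⟩⟩⟩
  have hnn : 0 ≤ ∫ t in Set.Ioi (0 : ℝ),
      ((t ^ (a * p + b * q - 1) * φ t - t ^ (a * p + b * q - 1) * (α + β * t) ^ s⁻¹) -
        c * (t ^ (p - 1) * φ t - t ^ (p - 1) * (α + β * t) ^ s⁻¹)) -
        d * (t ^ (q - 1) * φ t - t ^ (q - 1) * (α + β * t) ^ s⁻¹) := by
    refine setIntegral_nonneg measurableSet_Ioi fun t ht => ?_
    have ht : 0 < t := ht
    have hx : 0 < t ^ (q - p) := rpow_pos_of_pos ht _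
    have hxt : (t ^ (q - p)) ^ (q - p)⁻¹ = t := rpow_rpow_inv ht.le hd.ne'
    have e1 : t ^ (a * p + b * q - 1) = t ^ (p - 1) * (t ^ (q - p)) ^ b := by
      rw [← rpow_mul ht.le, ← rpow_add ht]
      congr 1
      linear_combination p * hab
    have e2 : t ^ (q - 1) = t ^ (p - 1) * t ^ (q - p) := by
      rw [← rpow_add ht]
      congr 1
      ring
    have e3 : ((t ^ (a * p + b * q - 1) * φ t - t ^ (a * p + b * q - 1) * (α + β * t) ^ s⁻¹) -
        c * (t ^ (p - 1) * φ t - t ^ (p - 1) * (α + β * t) ^ s⁻¹)) -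
        d * (t ^ (q - 1) * φ t - t ^ (q - 1) * (α + β * t) ^ s⁻¹) =
        t ^ (p - 1) * (((t ^ (q - p)) ^ b - c - d * t ^ (q - p)) *
          (φ t - (α + β * t) ^ s⁻¹)) := by
      rw [e1, e2]
      ring
    rw [e3]
    refine mul_nonneg (by positivity) ?_
    by_cases hmem : t ∈ S
    · exact mul_nonneg (hin _ ⟨hx, by rwa [hxt]⟩) (sub_nonneg.2 hmem.2.le)
    · refine mul_nonneg_of_nonpos_of_nonpos (hout _ hx fun h => hmem ?_) ?_
      · rw [← hxt]
        exact h.2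
      · exact sub_nonpos.2 (not_lt.1 fun h => hmem ⟨ht, h⟩)
  have hdr := integral_sub hir hjr
  have hdp := integral_sub hip hjp
  have hdq := integral_sub hiq hjq
  have hsum := integral_sub ((hir.sub hjr).sub ((hip.sub hjp).const_mul c))
    ((hiq.sub hjq).const_mul d)
  have hsum' := integral_sub (hir.sub hjr) ((hip.sub hjp).const_mul c)
  simp only [Pi.sub_apply, integral_const_mul] at hsum hsum'
  rw [hsum, hsum', hdr, hdp, hdq, hep, heq] at hnn
  linarith

theorem integral_rpow_mul_eq_zero_of_integral_eq_zero {p q : ℝ} {φ : ℝ → ℝ} (hφ : ∀ t, 0 ≤ φ t)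
    (hint : IntegrableOn (fun t => t ^ (p - 1) * φ t) (Set.Ioi 0))
    (h0 : ∫ t in Set.Ioi (0 : ℝ), t ^ (p - 1) * φ t = 0) :
    ∫ t in Set.Ioi (0 : ℝ), t ^ (q - 1) * φ t = 0 := by
  rw [integral_eq_zero_iff_of_nonneg_ae ?_ hint] at h0
  · refine integral_eq_zero_of_ae ?_
    filter_upwards [h0, ae_restrict_mem measurableSet_Ioi] with t h ht
    rcases mul_eq_zero.1 h with h | h
    · exact absurd h (rpow_pos_of_pos ht _).ne'
    · simp [h]
  · filter_upwards [ae_restrict_mem measurableSet_Ioi] with t ht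
    exact mul_nonneg (rpow_pos_of_pos ht _).le (hφ t)

/-- For `s < 0` and `φ : [0,∞) → [0,∞)` integrable and `s`-concave
(i.e. `φ^s` is convex on the support of `φ`),
`p ↦ B(p, -1/s - p)⁻¹ ∫₀^∞ t^{p-1} φ(t) dt` is log-concave on `(0, -1/s)`. -/
theorem stmt6
    (s : ℝ) (hs : s < 0) (φ : ℝ → ℝ)
    (hφ_nonneg : ∀ t, 0 ≤ φ t)
    (hφ_int : IntegrableOn φ (Set.Ioi (0 : ℝ)))
    (hφ_conv : ConvexOn ℝ {t : ℝ | 0 ≤ t ∧ 0 < φ t} (fun t => φ t ^ s)) :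
    ConcaveOn ℝ (Set.Ioo (0 : ℝ) (-1 / s))
      (fun p => Real.log ((betaFn p (-1 / s - p))⁻¹ * ∫ t in Set.Ioi (0 : ℝ), t ^ (p - 1) * φ t)) := by
  have hm : 0 < -1 / s := div_pos_of_neg_of_neg (by norm_num) hs
  refine LinearOrder.concaveOn_of_lt (convex_Ioo _ _) fun p hp q hq hpq a b ha hb hab => ?_
  have hr : a * p + b * q ∈ Set.Ioo 0 (-1 / s) :=
    (convex_Ioo (0 : ℝ) (-1 / s)) hp hq ha.le hb.le hab
  simp only [smul_eq_mul]
  by_cases hip : IntegrableOn (fun t => t ^ (p - 1) * φ t) (Set.Ioi 0)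
  swap
  · have hni : ∀ r ∈ Set.Ioo 0 (-1 / s), ∫ t in Set.Ioi (0 : ℝ), t ^ (r - 1) * φ t = 0 :=
      fun r hr => integral_undef fun h => hip
        (integrableOn_rpow_mul_of_integrableOn hs hr hp hφ_nonneg hφ_int hφ_conv h)
    simp [hni p hp, hni q hq, hni _ hr]
  have hall : ∀ r ∈ Set.Ioo 0 (-1 / s), IntegrableOn (fun t => t ^ (r - 1) * φ t) (Set.Ioi 0) :=
    fun r hr => integrableOn_rpow_mul_of_integrableOn hs hp hr hφ_nonneg hφ_int hφ_conv hip
  by_cases h0 : ∫ t in Set.Ioi (0 : ℝ), t ^ (p - 1) * φ t = 0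
  · have hz := fun r => integral_rpow_mul_eq_zero_of_integral_eq_zero (q := r) hφ_nonneg hip h0
    simp [hz]
  have hpos : ∀ r ∈ Set.Ioo 0 (-1 / s), 0 < ∫ t in Set.Ioi (0 : ℝ), t ^ (r - 1) * φ t :=
    fun r hr => lt_of_le_of_ne
      (setIntegral_nonneg measurableSet_Ioi fun t ht =>
        mul_nonneg (rpow_pos_of_pos ht _).le (hφ_nonneg t))
      fun h => h0 (integral_rpow_mul_eq_zero_of_integral_eq_zero hφ_nonneg (hall r hr) h.symm)
  have hB : ∀ r ∈ Set.Ioo 0 (-1 / s), 0 < betaFn r (-1 / s - r) :=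
    fun r hr => betaFn_pos hr.1 (sub_pos.2 hr.2)
  set L : ℝ → ℝ := fun r =>
    Real.log ((betaFn r (-1 / s - r))⁻¹ * ∫ t in Set.Ioi (0 : ℝ), t ^ (r - 1) * φ t) with hL
  set k := (L q - L p) / (q - p)
  have hkd : k * (q - p) = L q - L p := div_mul_cancel₀ _ (sub_pos.2 hpq).ne'
  set A := (k * p - L p) / (-1 / s)
  have hAm : A * (-1 / s) = k * p - L p := div_mul_cancel₀ _ hm.ne'
  have hJ : ∀ r ∈ Set.Ioo 0 (-1 / s),
      ∫ t in Set.Ioi (0 : ℝ), t ^ (r - 1) * (exp A + exp (A - k) * t) ^ (-(-1 / s)) =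
        betaFn r (-1 / s - r) * exp (L p + k * (r - p)) := fun r hr => by
    rw [integral_rpow_mul_add_mul_rpow_Ioi hr.1 hr.2 (exp_pos _) (exp_pos _), ← exp_mul,
      ← exp_mul, ← exp_add]
    congr 2
    linear_combination -hAm
  have hI : ∀ r ∈ Set.Ioo 0 (-1 / s),
      ∫ t in Set.Ioi (0 : ℝ), t ^ (r - 1) * φ t = betaFn r (-1 / s - r) * exp (L r) :=
    fun r hr => by
      rw [hL, exp_log (mul_pos (inv_pos.2 (hB r hr)) (hpos r hr)),
        mul_inv_cancel_left₀ (hB r hr).ne']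
  have hle := integral_rpow_mul_add_mul_rpow_le hs hp hq hpq ha hb hab (exp_pos A)
    (exp_pos (A - k)) hφ_conv hip (hall q hq) (hall _ hr)
    (by rw [hI p hp, hJ p hp, sub_self, mul_zero, add_zero])
    (by rw [hI q hq, hJ q hq, hkd, add_sub_cancel])
  rw [hI _ hr, hJ _ hr, mul_le_mul_iff_right₀ (hB _ hr), exp_le_exp] at hle
  change a * L p + b * L q ≤ L (a * p + b * q)
  refine le_trans (le_of_eq ?_) hle
  obtain rfl : a = 1 - b := by linarith
  linear_combination -b * hkd
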